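/- Let S = {k, l, m} be three distinct edges and ω ∈ Ω an environment such that k is a direction-switching edge with respect to (l, m) on ω. Then b ≥ 3a, and the third-order environment derivative satisfies ∂_S f(ω) ≥ 3a − b. -/

import Mathlib

noncomputable section

/-! ### First-passage percolation model

Vertices are points of `ℤ^d`; two vertices are adjacent when their ℓ¹-distance is `1`.
For `n : ℕ`, the graph is restricted to the box `[-2n, 2n]^d`; `EdgeSet d n` is its edge
set `W_n`, and an environment `ω ∈ Ω_n = {a,b}^{W_n}` is modelled as a function
`Sym2 (Vtx d) → ℝ` whose values on `W_n` lie in `{a, b}` (`ValidEnv`).  `fppT d v n ω`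
is the minimal passage time from the source `0` to the sink `n • v`. -/

abbrev Vtx (d : ℕ) : Type := Fin d → ℤ

/-- Two lattice points are adjacent when their ℓ¹ distance equals 1. -/
def adjV {d : ℕ} (x y : Vtx d) : Prop := (∑ i, |x i - y i|) = 1

/-- A vertex lies in the box `[-2n, 2n]^d`. -/
def inBox {d : ℕ} (n : ℕ) (x : Vtx d) : Prop := ∀ i, |x i| ≤ (2 * n : ℤ)

/-- The edge set `W_n`: nearest-neighbour pairs inside the box. -/
def EdgeSet (d n : ℕ) : Set (Sym2 (Vtx d)) :=
  {e | ∃ x y : Vtx d, e = s(x, y) ∧ adjV x y ∧ inBox n x ∧ inBox n y}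

/-- `p` is a path from `u` to `w` inside the box `[-2n, 2n]^d`. -/
def IsPath {d : ℕ} (n : ℕ) (u w : Vtx d) (p : List (Vtx d)) : Prop :=
  p.Chain' adjV ∧ p.head? = some u ∧ p.getLast? = some w ∧ ∀ x ∈ p, inBox n x

/-- The passage time `T(p, ω)`: the sum of `ω_e` over the edges of `p`. -/
def pathTime {d : ℕ} (ω : Sym2 (Vtx d) → ℝ) (p : List (Vtx d)) : ℝ :=
  ((p.zip p.tail).map fun q => ω s(q.1, q.2)).sum

/-- The first-passage time `f_n(ω)`: minimal passage time from `0` to `n • v`. -/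
def fppT (d : ℕ) (v : Vtx d) (n : ℕ) (ω : Sym2 (Vtx d) → ℝ) : ℝ :=
  sInf {t : ℝ | ∃ p : List (Vtx d), IsPath n 0 (fun i => (n : ℤ) * v i) p ∧ t = pathTime ω p}

/-- A geodesic: a path from `0` to `n • v` attaining the minimal passage time. -/
def IsGeodesic (d : ℕ) (v : Vtx d) (n : ℕ) (ω : Sym2 (Vtx d) → ℝ) (p : List (Vtx d)) : Prop :=
  IsPath n 0 (fun i => (n : ℤ) * v i) p ∧ pathTime ω p = fppT d v n ω

/-- The list of edges traversed by a path. -/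
def edgesOf {d : ℕ} (p : List (Vtx d)) : List (Sym2 (Vtx d)) :=
  (p.zip p.tail).map fun q => s(q.1, q.2)

/-- First-order environment derivative `∂_j φ = φ∘σ_j^b − φ∘σ_j^a`, where `σ_j^δ` sets
coordinate `j` to `δ`. -/
def envDeriv {E : Type*} [DecidableEq E] (a b : ℝ) (j : E) (φ : (E → ℝ) → ℝ) : (E → ℝ) → ℝ :=
  fun ω => φ (Function.update ω j b) - φ (Function.update ω j a)

/-- Higher-order environment derivative `∂_S φ`, obtained by iterating the first-order
derivative over the elements of `S` (the recursion `∂_S φ = ∂_{S∖{j}}(∂_j φ)`; the result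
is independent of the order). -/
def envDerivOn {E : Type*} [DecidableEq E] (a b : ℝ) (S : Finset E) (φ : (E → ℝ) → ℝ) :
    (E → ℝ) → ℝ :=
  S.toList.foldr (fun j ψ => envDeriv a b j ψ) φ

/-- `ω ∈ Ω_n = {a,b}^{W_n}`: the environment takes only the values `a`, `b` on `W_n`. -/
def ValidEnv (d n : ℕ) (a b : ℝ) (ω : Sym2 (Vtx d) → ℝ) : Prop :=
  ∀ e ∈ EdgeSet d n, ω e = a ∨ ω e = b

lemma edgesOf_cons2 {d : ℕ} (x y : Vtx d) (t : List (Vtx d)) :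
    edgesOf (x :: y :: t) = s(x, y) :: edgesOf (y :: t) := by
  simp [edgesOf]

lemma edgesOf_single {d : ℕ} (x : Vtx d) : edgesOf [x] = [] := by
  simp [edgesOf]

lemma edgesOf_split {d : ℕ} (x : Vtx d) (t : List (Vtx d)) : ∀ s : List (Vtx d),
    edgesOf (s ++ x :: t) = edgesOf (s ++ [x]) ++ edgesOf (x :: t)
  | [] => by simp [edgesOf_single]
  | [y] => by simp [edgesOf_single, edgesOf_cons2]
  | y :: z :: s => by
    have := edgesOf_split x t (z :: s)
    simp only [List.cons_append] at this ⊢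
    rw [edgesOf_cons2, edgesOf_cons2, this, List.cons_append]

lemma pathTime_eq {d : ℕ} (ω : Sym2 (Vtx d) → ℝ) (p : List (Vtx d)) :
    pathTime ω p = ((edgesOf p).map ω).sum := by
  simp [pathTime, edgesOf, Function.comp_def]

lemma pathTime_split {d : ℕ} (ω : Sym2 (Vtx d) → ℝ) (x : Vtx d) (t s : List (Vtx d)) :
    pathTime ω (s ++ x :: t) = pathTime ω (s ++ [x]) + pathTime ω (x :: t) := by
  simp [pathTime_eq, edgesOf_split x t s]

lemma pathTime_cons2 {d : ℕ} (ω : Sym2 (Vtx d) → ℝ) (x y : Vtx d) (t : List (Vtx d)) :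
    pathTime ω (x :: y :: t) = ω s(x, y) + pathTime ω (y :: t) := by
  simp [pathTime_eq, edgesOf_cons2]

lemma isPath_split {d n : ℕ} (u w x : Vtx d) (s t : List (Vtx d)) :
    IsPath n u w (s ++ x :: t) ↔ IsPath n u x (s ++ [x]) ∧ IsPath n x w (x :: t) := by
  have h1 : (s ++ x :: t).head? = (s ++ [x]).head? := by cases s <;> simp
  have h2 : (s ++ x :: t).getLast? = (x :: t).getLast? := by
    simp [List.getLast?_append]
    cases h : (x :: t).getLast? <;> simp_all
  have h3 : List.IsChain adjV (s ++ x :: t) ↔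
      List.IsChain adjV (s ++ [x]) ∧ List.IsChain adjV (x :: t) := List.isChain_split
  unfold IsPath
  rw [h1, h2]
  change (List.IsChain adjV (s ++ x :: t) ∧ _) ↔ (List.IsChain adjV (s ++ [x]) ∧ _) ∧
    (List.IsChain adjV (x :: t) ∧ _)
  rw [h3]
  simp only [List.mem_append, List.mem_cons, List.getLast?_append, List.head?_cons]
  simp
  grind

lemma edges_mem {d n : ℕ} {w : Vtx d} : ∀ {p : List (Vtx d)} {u : Vtx d}, IsPath n u w p →
    ∀ e ∈ edgesOf p, e ∈ EdgeSet d n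
  | [], _, _ => by simp [edgesOf]
  | [x], _, _ => by simp [edgesOf]
  | x :: y :: t, u, h => by
    have h2 := (isPath_split u w y [x] t).1 h
    intro e he
    rw [edgesOf_cons2, List.mem_cons] at he
    rcases he with rfl | he
    · obtain ⟨⟨hc, -, -, hb⟩, -⟩ := h2
      have hc' : List.IsChain adjV [x, y] := hc
      simp at hc'
      exact ⟨x, y, rfl, hc', hb x (by simp), hb y (by simp)⟩
    · exact edges_mem h2.2 e he

lemma pathTime_mono {d n : ℕ} {u w : Vtx d} {p : List (Vtx d)} (hp : IsPath n u w p)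
    {ω ω' : Sym2 (Vtx d) → ℝ} (h : ∀ e ∈ EdgeSet d n, ω e ≤ ω' e) :
    pathTime ω p ≤ pathTime ω' p := by
  rw [pathTime_eq, pathTime_eq]
  exact List.sum_le_sum fun e he => h e (edges_mem hp e he)

lemma pathTime_nonneg {d n : ℕ} {u w : Vtx d} {p : List (Vtx d)} (hp : IsPath n u w p)
    {ω : Sym2 (Vtx d) → ℝ} (h : ∀ e ∈ EdgeSet d n, 0 < ω e) :
    0 ≤ pathTime ω p := by
  rw [pathTime_eq]
  apply List.sum_nonneg
  intro x hx
  obtain ⟨e, he, rfl⟩ := List.mem_map.1 hx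
  exact (h e (edges_mem hp e he)).le

lemma fppT_le {d n : ℕ} {v : Vtx d} {p : List (Vtx d)}
    (hp : IsPath n 0 (fun i => (n : ℤ) * v i) p)
    {ω : Sym2 (Vtx d) → ℝ} (h : ∀ e ∈ EdgeSet d n, 0 < ω e) :
    fppT d v n ω ≤ pathTime ω p := by
  apply csInf_le
  · refine ⟨0, ?_⟩
    rintro t ⟨q, hq, rfl⟩
    exact pathTime_nonneg hq h
  · exact ⟨p, hp, rfl⟩

lemma fppT_mono {d n : ℕ} {v : Vtx d} {p : List (Vtx d)}
    (hp : IsPath n 0 (fun i => (n : ℤ) * v i) p)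
    {ω ω' : Sym2 (Vtx d) → ℝ} (h0 : ∀ e ∈ EdgeSet d n, 0 < ω e)
    (h : ∀ e ∈ EdgeSet d n, ω e ≤ ω' e) :
    fppT d v n ω ≤ fppT d v n ω' := by
  apply le_csInf
  · exact ⟨_, p, hp, rfl⟩
  · rintro t ⟨q, hq, rfl⟩
    exact (fppT_le hq h0).trans (pathTime_mono hq h)

lemma edgesOf_nodup {d : ℕ} : ∀ {p : List (Vtx d)}, p.Nodup → (edgesOf p).Nodup
  | [], _ => by simp [edgesOf]
  | [x], _ => by simp [edgesOf]
  | x :: y :: t, h => by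
    rw [edgesOf_cons2, List.nodup_cons]
    rw [List.nodup_cons] at h
    refine ⟨fun hmem => h.1 ?_, edgesOf_nodup h.2⟩
    unfold edgesOf at hmem
    obtain ⟨⟨c, e⟩, hq, he⟩ := List.mem_map.1 hmem
    have h1 := (List.of_mem_zip hq).1
    have h2 := List.mem_of_mem_tail (List.of_mem_zip hq).2
    simp only [Sym2.eq_iff] at he
    grind

lemma geod_nodup {d n : ℕ} {v : Vtx d} {p : List (Vtx d)} {ω : Sym2 (Vtx d) → ℝ}
    (h : ∀ e ∈ EdgeSet d n, 0 < ω e) (hp : IsGeodesic d v n ω p) : p.Nodup := by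
  by_contra hnd
  rw [← List.exists_duplicate_iff_not_nodup] at hnd
  obtain ⟨x, hx⟩ := hnd
  obtain ⟨s, t, r, rfl⟩ : ∃ s t r, p = s ++ x :: (t ++ x :: r) := by
    clear hp
    induction hx with
    | cons_mem hm =>
      obtain ⟨t, r, rfl⟩ := List.append_of_mem hm
      exact ⟨[], t, r, rfl⟩
    | cons_duplicate _ ih =>
      obtain ⟨s, t, r, rfl⟩ := ih
      exact ⟨_ :: s, t, r, rfl⟩
  obtain ⟨hp1, hp2⟩ := hp
  obtain ⟨hA, hB⟩ := (isPath_split _ _ _ _ _).1 hp1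
  obtain ⟨hC, hD⟩ := (isPath_split _ _ x (x :: t) r).1 hB
  have hle := fppT_le ((isPath_split _ _ _ _ _).2 ⟨hA, hD⟩) h
  have e1 := pathTime_split ω x (t ++ x :: r) s
  have e2 := pathTime_split ω x r (x :: t)
  have e3 := pathTime_split ω x r s
  have hpos : 0 < pathTime ω (x :: t ++ [x]) := by
    cases t with
    | nil =>
      have := h s(x, x) (edges_mem hC _ (by simp [edgesOf]))
      simpa [pathTime] using this
    | cons y t =>
      have h1 := h s(x, y) (edges_mem hC _ (by simp [edgesOf]))
      have h2 := pathTime_nonneg ((isPath_split _ _ y [x] (t ++ [x])).1 hC).2 h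
      have h3 := pathTime_cons2 ω x y (t ++ [x])
      simp only [List.cons_append] at *
      linarith
  simp only [List.cons_append] at *
  linarith

lemma pathTime_update_of_notMem {d : ℕ} {ω : Sym2 (Vtx d) → ℝ} {p : List (Vtx d)}
    {e : Sym2 (Vtx d)} (c c' : ℝ) (he : e ∉ edgesOf p) :
    pathTime (Function.update ω e c) p = pathTime (Function.update ω e c') p := by
  rw [pathTime_eq, pathTime_eq]
  congr 1
  apply List.map_congr_left
  intro x hx
  have : x ≠ e := by rintro rfl; exact he hx
  simp [this]

lemma sum_update_le {E : Type*} [DecidableEq E] (ω : E → ℝ) (e : E) {a b : ℝ} (hab : a ≤ b) :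
    ∀ L : List E, L.Nodup → (L.map (Function.update ω e b)).sum ≤
      (L.map (Function.update ω e a)).sum + (b - a)
  | [], _ => by simpa using hab
  | x :: L, h => by
    rw [List.nodup_cons] at h
    by_cases hx : x = e
    · subst hx
      have : L.map (Function.update ω x b) = L.map (Function.update ω x a) := by
        apply List.map_congr_left
        intro y hy
        have : y ≠ x := by rintro rfl; exact h.1 hy
        simp [this]
      simp [this]
      linarith
    · have := sum_update_le ω e hab L h.2
      simp [hx]
      linarith

lemma pathTime_update_le {d : ℕ} {ω : Sym2 (Vtx d) → ℝ} {p : List (Vtx d)}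
    {e : Sym2 (Vtx d)} {a b : ℝ} (hab : a ≤ b) (hp : p.Nodup) :
    pathTime (Function.update ω e b) p ≤ pathTime (Function.update ω e a) p + (b - a) := by
  rw [pathTime_eq, pathTime_eq]
  exact sum_update_le ω e hab _ (edgesOf_nodup hp)

lemma envDeriv_comm {E : Type*} [DecidableEq E] (a b : ℝ) (i j : E) (φ : (E → ℝ) → ℝ) :
    envDeriv a b i (envDeriv a b j φ) = envDeriv a b j (envDeriv a b i φ) := by
  by_cases hij : i = j
  · rw [hij]
  · funext ω
    simp only [envDeriv]
    rw [Function.update_comm hij, Function.update_comm hij, Function.update_comm hij,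
      Function.update_comm hij]
    ring

lemma envDerivOn_three {E : Type*} [DecidableEq E] (a b : ℝ) {k l m : E}
    (hkl : k ≠ l) (hkm : k ≠ m) (hlm : l ≠ m) (φ : (E → ℝ) → ℝ) :
    envDerivOn a b {k, l, m} φ = envDeriv a b m (envDeriv a b l (envDeriv a b k φ)) := by
  have hperm : (({k, l, m} : Finset E).toList).Perm [m, l, k] := by
    rw [List.perm_ext_iff_of_nodup (Finset.nodup_toList _) (by grind)]
    intro x
    simp
    tauto
  haveI : LeftCommutative (fun (j : E) (ψ : (E → ℝ) → ℝ) => envDeriv a b j ψ) :=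
    ⟨fun i j ψ => envDeriv_comm a b i j ψ⟩
  unfold envDerivOn
  rw [hperm.foldr_eq]
  rfl

lemma notMem_of_nodup_mid {E : Type*} {L M : List E} {x : E} (h : (L ++ x :: M).Nodup) :
    x ∉ L ∧ x ∉ M := by
  rw [List.nodup_append, List.nodup_cons] at h
  exact ⟨fun hx => h.2.2 x hx x (by simp) rfl, h.2.1.1⟩

/--
Let `S = {k, l, m}` be three distinct edges of `W_n` and `ω ∈ Ω_n` such
that `k` (with endpoints `K₁`, `K₂`) is a direction-switching edge with respect to `(l, m)`
on `ω`: on `σ_k^a σ_l^a σ_m^b(ω)` there is a geodesic traversing `k` from `K₁` to `K₂`,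
while on `σ_k^a σ_l^b σ_m^a(ω)` there is a geodesic traversing `k` from `K₂` to `K₁`.
Then `b ≥ 3a` and `∂_S f(ω) ≥ 3a − b`.
-/
theorem direction_switch_deriv_bound (d : ℕ) (hd : 2 ≤ d) (a b : ℝ) (ha : 0 < a)
    (hab : a < b) (v : Vtx d) (hv : ∀ i, |v i| ≤ 2) (n : ℕ)
    (K₁ K₂ : Vtx d) (k l m : Sym2 (Vtx d)) (hkdef : k = s(K₁, K₂))
    (hk : k ∈ EdgeSet d n) (hl : l ∈ EdgeSet d n) (hm : m ∈ EdgeSet d n)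
    (hkl : k ≠ l) (hkm : k ≠ m) (hlm : l ≠ m)
    (ω : Sym2 (Vtx d) → ℝ) (hω : ValidEnv d n a b ω)
    (hswitch₁ : ∃ p₁ p₂ : List (Vtx d), IsGeodesic d v n
      (Function.update (Function.update (Function.update ω m b) l a) k a)
      (p₁ ++ K₁ :: K₂ :: p₂))
    (hswitch₂ : ∃ q₁ q₂ : List (Vtx d), IsGeodesic d v n
      (Function.update (Function.update (Function.update ω m a) l b) k a)
      (q₁ ++ K₂ :: K₁ :: q₂)) :
    b ≥ 3 * a ∧ envDerivOn a b {k, l, m} (fppT d v n) ω ≥ 3 * a - b := by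
  subst hkdef
  obtain ⟨p₁, p₂, hP⟩ := hswitch₁
  obtain ⟨q₁, q₂, hQ⟩ := hswitch₂
  rw [envDerivOn_three a b hkl hkm hlm]
  simp only [envDeriv]
  set g : ℝ → ℝ → ℝ → Sym2 (Vtx d) → ℝ := fun κ lam μ =>
    Function.update (Function.update (Function.update ω m μ) l lam) s(K₁, K₂) κ with hg
  have hb : 0 < b := ha.trans hab
  have gpos : ∀ κ lam μ, 0 < κ → 0 < lam → 0 < μ → ∀ e ∈ EdgeSet d n, 0 < g κ lam μ e := by
    intro κ lam μ h1 h2 h3 e he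
    have : 0 < ω e := by rcases hω e he with h | h <;> rw [h] <;> assumption
    simp only [hg, Function.update_apply]
    split_ifs <;> assumption
  have gmono : ∀ κ lam μ κ' lam' μ', κ ≤ κ' → lam ≤ lam' → μ ≤ μ' →
      ∀ e ∈ EdgeSet d n, g κ lam μ e ≤ g κ' lam' μ' e := by
    intro κ lam μ κ' lam' μ' h1 h2 h3 e he
    simp only [hg, Function.update_apply]
    split_ifs <;> first | assumption | exact le_rfl
  change IsGeodesic d v n (g a a b) _ at hP
  change IsGeodesic d v n (g a b a) _ at hQ
  change b ≥ 3 * a ∧ fppT d v n (g b b b) - fppT d v n (g a b b) -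
    (fppT d v n (g b a b) - fppT d v n (g a a b)) -
    ((fppT d v n (g b b a) - fppT d v n (g a b a)) -
    (fppT d v n (g b a a) - fppT d v n (g a a a))) ≥ 3 * a - b
  have hPn := geod_nodup (gpos a a b ha ha hb) hP
  have hQn := geod_nodup (gpos a b a ha hb ha) hQ
  obtain ⟨hP, hPt⟩ := hP
  obtain ⟨hQ, hQt⟩ := hQ
  have D : ∀ lam μ, 0 < lam → 0 < μ → fppT d v n (g a lam μ) ≤ fppT d v n (g b lam μ) :=
    fun lam μ h1 h2 => fppT_mono hP (gpos _ _ _ ha h1 h2)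
      (gmono _ _ _ _ _ _ hab.le le_rfl le_rfl)
  have hPe := edgesOf_nodup hPn
  have hQe := edgesOf_nodup hQn
  rw [edgesOf_split, edgesOf_cons2] at hPe hQe
  rw [Sym2.eq_swap (a := K₂)] at hQe
  have nA : s(K₁, K₂) ∉ edgesOf (p₁ ++ [K₁]) := (notMem_of_nodup_mid hPe).1
  have nB : s(K₁, K₂) ∉ edgesOf (K₂ :: p₂) := (notMem_of_nodup_mid hPe).2
  have nC : s(K₁, K₂) ∉ edgesOf (q₁ ++ [K₂]) := (notMem_of_nodup_mid hQe).1
  have nD : s(K₁, K₂) ∉ edgesOf (K₁ :: q₂) := (notMem_of_nodup_mid hQe).2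
  obtain ⟨pA, pB⟩ := (isPath_split _ _ _ _ _).1 hP
  have pB := ((isPath_split _ _ K₂ [K₁] p₂).1 pB).2
  obtain ⟨pC, pD⟩ := (isPath_split _ _ _ _ _).1 hQ
  have pD := ((isPath_split _ _ K₁ [K₂] q₂).1 pD).2
  have pAD := (isPath_split _ _ _ _ _).2 ⟨pA, pD⟩
  have pCB := (isPath_split _ _ _ _ _).2 ⟨pC, pB⟩
  have key : ∀ lam μ, 0 < lam → 0 < μ → 2 * fppT d v n (g b lam μ) ≤
      pathTime (g a lam μ) (p₁ ++ K₁ :: K₂ :: p₂) +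
      pathTime (g a lam μ) (q₁ ++ K₂ :: K₁ :: q₂) - 2 * a := by
    intro lam μ h1 h2
    have i1 := fppT_le pAD (gpos b lam μ hb h1 h2)
    have i2 := fppT_le pCB (gpos b lam μ hb h1 h2)
    rw [pathTime_split] at i1 i2
    rw [pathTime_split, pathTime_cons2, pathTime_split _ _ (K₁ :: q₂), pathTime_cons2,
      Sym2.eq_swap (a := K₂)]
    have hk' : g a lam μ s(K₁, K₂) = a := by simp [hg]
    have eA : pathTime (g b lam μ) _ = pathTime (g a lam μ) _ := pathTime_update_of_notMem b a nA
    have eB : pathTime (g b lam μ) _ = pathTime (g a lam μ) _ := pathTime_update_of_notMem b a nB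
    have eC : pathTime (g b lam μ) _ = pathTime (g a lam μ) _ := pathTime_update_of_notMem b a nC
    have eD : pathTime (g b lam μ) _ = pathTime (g a lam μ) _ := pathTime_update_of_notMem b a nD
    rw [hk']
    linarith
  have g_l : ∀ κ lam μ, g κ lam μ =
      Function.update (Function.update (Function.update ω m μ) s(K₁, K₂) κ) l lam := by
    intro κ lam μ
    simp only [hg]
    rw [Function.update_comm hkl.symm]
  have g_m : ∀ κ lam μ, g κ lam μ =
      Function.update (Function.update (Function.update ω l lam) s(K₁, K₂) κ) m μ := by
    intro κ lam μ
    simp only [hg]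
    rw [Function.update_comm hlm.symm, Function.update_comm hkm.symm]
  have u1 : pathTime (g a b a) (p₁ ++ K₁ :: K₂ :: p₂) ≤
      pathTime (g a a b) (p₁ ++ K₁ :: K₂ :: p₂) + (b - a) := by
    refine (pathTime_mono hP (gmono a b a a b b le_rfl le_rfl hab.le)).trans ?_
    rw [g_l, g_l]
    exact pathTime_update_le hab.le hPn
  have u2 : pathTime (g a a b) (q₁ ++ K₂ :: K₁ :: q₂) ≤
      pathTime (g a b a) (q₁ ++ K₂ :: K₁ :: q₂) + (b - a) := by
    refine (pathTime_mono hQ (gmono a a b a b b le_rfl hab.le le_rfl)).trans ?_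
    rw [g_m, g_m]
    exact pathTime_update_le hab.le hQn
  have k1 := key a b ha hb
  have k2 := key b a hb ha
  have d1 := D a a ha ha
  have d2 := D a b ha hb
  have d3 := D b a hb ha
  have d4 := D b b hb hb
  constructor <;> linarith

end
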